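/- arXiv:2303.05335 — 2 statements merged into one kernel-verified Lean document; each statement's English description precedes it below -/
import Mathlib

section
/- Let H be a right quaternionic Hilbert space and T ∈ B(H). Then the residual spectrum of T equals the residual S-spectrum of T: σ_r(T) = σ_{S,r}(T). -/
open MulOpposite Filter Topology Quaternion

noncomputable section

/- We model a right quaternionic Hilbert space as a real Banach space `H` equipped with a
right `ℍ`-module structure (encoded as a `ℍ[ℝ]ᵐᵒᵖ`-module, so that `x·q` is `op q • x`),
compatible with the real structure (`hreal`) and with the norm (`hnorm`). -/

variable {H : Type*} [NormedAddCommGroup H] [NormedSpace ℝ H] [Module ℍ[ℝ]ᵐᵒᵖ H]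

/-- The operator `T_λ : x ↦ x·λ - T x`. -/
def opTlam (T : H →L[ℝ] H) (l : ℍ[ℝ]) : H → H := fun x => op l • x - T x

/-- The operator `Δ_λ(T) = T² - 2 Re(λ) T + |λ|² I`. -/
def opDelta (T : H →L[ℝ] H) (l : ℍ[ℝ]) : H → H :=
  fun x => T (T x) - (2 * l.re) • T x + (‖l‖ ^ 2) • x

/-- A map is right `ℍ`-linear when it commutes with the right quaternionic scalar action
(together with additivity, which is automatic for the bundled maps we use). -/
def IsRightQLinear (S : H → H) : Prop := ∀ (q : ℍ[ℝ]) (x : H), S (op q • x) = op q • S x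

/-- Invertibility in `B_ℝ(H)`: existence of a two-sided inverse which is a bounded
`ℝ`-linear operator. -/
def InvertibleInBR (f : H → H) : Prop :=
  ∃ S : H →L[ℝ] H, (∀ x, S (f x) = x) ∧ (∀ x, f (S x) = x)

/-- Invertibility in `B(H)`: existence of a two-sided inverse which is a bounded
right `ℍ`-linear operator. -/
def InvertibleInBH (f : H → H) : Prop :=
  ∃ S : H →L[ℝ] H, IsRightQLinear (S : H → H) ∧ (∀ x, S (f x) = x) ∧ (∀ x, f (S x) = x)

/-- An operator is bounded below if `‖f x‖ ≥ k ‖x‖` for some `k > 0`. -/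
def BoundedBelowOp (f : H → H) : Prop := ∃ k > 0, ∀ x : H, k * ‖x‖ ≤ ‖f x‖

/-- The right spectrum `σ(T)`. -/
def rightSpectrum (T : H →L[ℝ] H) : Set ℍ[ℝ] := {l | ¬ InvertibleInBR (opTlam T l)}

/-- The S-spectrum `σ_S(T)`. -/
def sSpectrum (T : H →L[ℝ] H) : Set ℍ[ℝ] := {l | ¬ InvertibleInBH (opDelta T l)}

/-- The point spectrum `σ_p(T)`. -/
def pointSpectrum (T : H →L[ℝ] H) : Set ℍ[ℝ] := {l | ∃ x : H, x ≠ 0 ∧ opTlam T l x = 0}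

/-- The point S-spectrum `σ_{S,p}(T)`. -/
def sPointSpectrum (T : H →L[ℝ] H) : Set ℍ[ℝ] := {l | ∃ x : H, x ≠ 0 ∧ opDelta T l x = 0}

/-- The residual spectrum `σ_r(T)`. -/
def residualSpectrum (T : H →L[ℝ] H) : Set ℍ[ℝ] :=
  {l | l ∉ pointSpectrum T ∧ ¬ Dense (Set.range (opTlam T l))}

/-- The residual S-spectrum `σ_{S,r}(T)`. -/
def sResidualSpectrum (T : H →L[ℝ] H) : Set ℍ[ℝ] :=
  {l | l ∉ sPointSpectrum T ∧ ¬ Dense (Set.range (opDelta T l))}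

/-- The continuous spectrum `σ_c(T)`. -/
def continuousSpectrum (T : H →L[ℝ] H) : Set ℍ[ℝ] :=
  {l | l ∉ pointSpectrum T ∧ l ∉ residualSpectrum T ∧ ¬ BoundedBelowOp (opTlam T l)}

/-- The continuous S-spectrum `σ_{S,c}(T)`. -/
def sContinuousSpectrum (T : H →L[ℝ] H) : Set ℍ[ℝ] :=
  {l | l ∉ sPointSpectrum T ∧ l ∉ sResidualSpectrum T ∧ ¬ BoundedBelowOp (opDelta T l)}

/-- Every quaternion is conjugate to its star. -/
lemma exists_ne_zero_mul_eq_star_mul (l : ℍ[ℝ]) : ∃ q : ℍ[ℝ], q ≠ 0 ∧ q * l = star l * q := by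
  have key (q : ℍ[ℝ]) (hr : q.re = 0) (hd : q.imI * l.imI + q.imJ * l.imJ + q.imK * l.imK = 0) :
      q * l = star l * q := by
    apply Quaternion.ext <;>
    simp only [Quaternion.re_mul, Quaternion.imI_mul, Quaternion.imJ_mul, Quaternion.imK_mul,
      Quaternion.re_star, Quaternion.imI_star, Quaternion.imJ_star, Quaternion.imK_star, hr] <;>
    linarith
  by_cases h : l.imI = 0 ∧ l.imJ = 0
  · refine ⟨⟨0, 1, 0, 0⟩, fun h0 => ?_, key _ rfl ?_⟩
    · simpa using congrArg QuaternionAlgebra.imI h0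
    · simp [h.1]
  · refine ⟨⟨0, l.imJ, -l.imI, 0⟩, fun h0 => h ⟨?_, ?_⟩, key _ rfl ?_⟩
    · simpa using congrArg QuaternionAlgebra.imJ h0
    · simpa using congrArg QuaternionAlgebra.imI h0
    · ring

lemma opTlam_smul {T : H →L[ℝ] H} (hT : IsRightQLinear (T : H → H)) {l m q : ℍ[ℝ]}
    (hq : q * l = m * q) (x : H) : opTlam T l (op q • x) = op q • opTlam T m x := by
  simp only [opTlam, hT q x, smul_sub, smul_smul, ← op_mul, hq]

lemma continuous_op_smul (hnorm : ∀ (x : H) (q : ℍ[ℝ]), ‖op q • x‖ = ‖x‖ * ‖q‖) (q : ℍ[ℝ]) :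
    Continuous fun x : H => op q • x :=
  AddMonoidHomClass.continuous_of_bound (DistribSMul.toAddMonoidHom H (op q)) ‖q‖ fun x => by
    simp [hnorm, mul_comm]

lemma continuous_opTlam (hnorm : ∀ (x : H) (q : ℍ[ℝ]), ‖op q • x‖ = ‖x‖ * ‖q‖)
    (T : H →L[ℝ] H) (l : ℍ[ℝ]) : Continuous (opTlam T l) :=
  (continuous_op_smul hnorm l).sub T.continuous

lemma opTlam_star_opTlam {T : H →L[ℝ] H} (hT : IsRightQLinear (T : H → H))
    (hreal : ∀ (r : ℝ) (x : H), op ((r : ℍ[ℝ])) • x = r • x) (l : ℍ[ℝ]) (x : H) :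
    opTlam T (star l) (opTlam T l x) = opDelta T l x := by
  have h1 : op (star l) • op l • x = (‖l‖ ^ 2) • x := by
    rw [smul_smul, ← op_mul, Quaternion.self_mul_star, hreal, Quaternion.normSq_eq_norm_mul_self,
      sq]
  have h2 : op (star l) • T x + op l • T x = (2 * l.re) • T x := by
    rw [← add_smul, ← op_add, Quaternion.star_add_self', ← hreal]
  simp only [opTlam, opDelta, smul_sub, map_sub, hT l x, h1, ← h2]
  abel

lemma opTlam_opTlam_star {T : H →L[ℝ] H} (hT : IsRightQLinear (T : H → H))
    (hreal : ∀ (r : ℝ) (x : H), op ((r : ℍ[ℝ])) • x = r • x) (l : ℍ[ℝ]) (x : H) :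
    opTlam T l (opTlam T (star l) x) = opDelta T l x := by
  have h := opTlam_star_opTlam hT hreal (star l) x
  rw [star_star] at h
  rw [h]
  simp [opDelta]

lemma pointSpectrum_eq_sPointSpectrum {T : H →L[ℝ] H} (hT : IsRightQLinear (T : H → H))
    (hreal : ∀ (r : ℝ) (x : H), op ((r : ℍ[ℝ])) • x = r • x) :
    pointSpectrum T = sPointSpectrum T := by
  ext l
  constructor
  · rintro ⟨x, hx, h⟩
    exact ⟨x, hx, by rw [← opTlam_star_opTlam hT hreal, h]; simp [opTlam]⟩
  · rintro ⟨x, hx, h⟩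
    by_cases h0 : opTlam T l x = 0
    · exact ⟨x, hx, h0⟩
    obtain ⟨q, hq, hql⟩ := exists_ne_zero_mul_eq_star_mul l
    refine ⟨op q • opTlam T l x, smul_ne_zero (by simpa using hq) h0, ?_⟩
    rw [opTlam_smul hT hql, opTlam_star_opTlam hT hreal, h, smul_zero]

lemma denseRange_opTlam_star {T : H →L[ℝ] H} (hT : IsRightQLinear (T : H → H))
    (hnorm : ∀ (x : H) (q : ℍ[ℝ]), ‖op q • x‖ = ‖x‖ * ‖q‖) {l : ℍ[ℝ]}
    (h : DenseRange (opTlam T l)) : DenseRange (opTlam T (star l)) := by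
  obtain ⟨q, hq, hql⟩ := exists_ne_zero_mul_eq_star_mul l
  have hq' : op q ≠ 0 := by simpa using hq
  have hsurj : Function.Surjective fun x : H => op q⁻¹ • x := fun y =>
    ⟨op q • y, by simp only [op_inv, inv_smul_smul₀ hq']⟩
  refine (hsurj.denseRange.comp h (continuous_op_smul hnorm q⁻¹)).mono ?_
  rintro _ ⟨x, rfl⟩
  refine ⟨op q⁻¹ • x, ?_⟩
  have := opTlam_smul hT hql (op q⁻¹ • x)
  simp only [op_inv, smul_inv_smul₀ hq'] at this
  simp only [Function.comp_apply, op_inv, this, inv_smul_smul₀ hq']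

lemma denseRange_opTlam_iff_opDelta {T : H →L[ℝ] H} (hT : IsRightQLinear (T : H → H))
    (hreal : ∀ (r : ℝ) (x : H), op ((r : ℍ[ℝ])) • x = r • x)
    (hnorm : ∀ (x : H) (q : ℍ[ℝ]), ‖op q • x‖ = ‖x‖ * ‖q‖) (l : ℍ[ℝ]) :
    DenseRange (opTlam T l) ↔ DenseRange (opDelta T l) := by
  have hcomp : opDelta T l = opTlam T l ∘ opTlam T (star l) :=
    funext fun x => (opTlam_opTlam_star hT hreal l x).symm
  rw [hcomp]
  exact ⟨fun h => h.comp (denseRange_opTlam_star hT hnorm h) (continuous_opTlam hnorm T l),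
    fun h => h.mono (Set.range_comp_subset_range _ _)⟩

/-- The residual spectrum equals the residual S-spectrum: `σ_r(T) = σ_{S,r}(T)`. -/
theorem residual_spectrum_eq_sResidualSpectrum [CompleteSpace H] (T : H →L[ℝ] H)
    (hT : IsRightQLinear (T : H → H))
    (hreal : ∀ (r : ℝ) (x : H), op ((r : ℍ[ℝ])) • x = r • x)
    (hnorm : ∀ (x : H) (q : ℍ[ℝ]), ‖op q • x‖ = ‖x‖ * ‖q‖) :
    residualSpectrum T = sResidualSpectrum T := by
  ext l
  simp only [residualSpectrum, sResidualSpectrum, Set.mem_ofPred_eq,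
    pointSpectrum_eq_sPointSpectrum hT hreal]
  exact and_congr_right' (denseRange_opTlam_iff_opDelta hT hreal hnorm l).not
end
end

section
/- Let H be a right quaternionic Hilbert space, T ∈ B(H), and λ ∈ ℍ. If the range of T_λ is dense in H, then the range of T_{λ*} is dense in H. -/
open MulOpposite Filter Topology Quaternion

noncomputable section

/- We model a right quaternionic Hilbert space as a real Banach space `H` equipped with a
right `ℍ`-module structure (encoded as a `ℍ[ℝ]ᵐᵒᵖ`-module, so that `x·q` is `op q • x`),
compatible with the real structure (`hreal`) and with the norm (`hnorm`). -/

variable {H : Type*} [NormedAddCommGroup H] [NormedSpace ℝ H] [Module ℍ[ℝ]ᵐᵒᵖ H]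

theorem Quaternion.mul_eq_mul_star_of_orthogonal {l q : ℍ[ℝ]} (hre : q.re = 0)
    (horth : l.imI * q.imI + l.imJ * q.imJ + l.imK * q.imK = 0) : l * q = q * star l := by
  apply Quaternion.ext
  · rw [Quaternion.re_mul, Quaternion.re_mul]
    simp only [Quaternion.re_star, Quaternion.imI_star, Quaternion.imJ_star, Quaternion.imK_star]
    linear_combination -2 * horth
  · rw [Quaternion.imI_mul, Quaternion.imI_mul]
    simp only [Quaternion.re_star, Quaternion.imI_star, Quaternion.imJ_star, Quaternion.imK_star]
    linear_combination 2 * l.imI * hre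
  · rw [Quaternion.imJ_mul, Quaternion.imJ_mul]
    simp only [Quaternion.re_star, Quaternion.imI_star, Quaternion.imJ_star, Quaternion.imK_star]
    linear_combination 2 * l.imJ * hre
  · rw [Quaternion.imK_mul, Quaternion.imK_mul]
    simp only [Quaternion.re_star, Quaternion.imI_star, Quaternion.imJ_star, Quaternion.imK_star]
    linear_combination 2 * l.imK * hre

/-- Every quaternion is conjugate to its star. -/
theorem Quaternion.exists_ne_zero_mul_eq_mul_star (l : ℍ[ℝ]) :
    ∃ q : ℍ[ℝ], q ≠ 0 ∧ l * q = q * star l := by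
  by_cases hl : l.imI = 0 ∧ l.imJ = 0
  · refine ⟨⟨0, 1, 0, 0⟩, fun hq => one_ne_zero (congrArg QuaternionAlgebra.imI hq),
      Quaternion.mul_eq_mul_star_of_orthogonal rfl ?_⟩
    simp [hl.1]
  · refine ⟨⟨0, l.imJ, -l.imI, 0⟩, fun hq => hl ⟨?_, ?_⟩,
      Quaternion.mul_eq_mul_star_of_orthogonal rfl ?_⟩
    · exact neg_eq_zero.mp (congrArg QuaternionAlgebra.imJ hq)
    · exact congrArg QuaternionAlgebra.imI hq
    · ring

theorem continuous_op_smul_of_norm {E : Type*} [NormedAddCommGroup E] [Module ℍ[ℝ]ᵐᵒᵖ E]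
    (hnorm : ∀ (x : E) (q : ℍ[ℝ]), ‖op q • x‖ = ‖x‖ * ‖q‖) (q : ℍ[ℝ]) :
    Continuous fun x : E => op q • x :=
  AddMonoidHomClass.continuous_of_bound (DistribSMul.toAddMonoidHom E (op q)) ‖q‖
    fun x => by simp [hnorm, mul_comm]

theorem op_smul_opTlam (T : H →L[ℝ] H) (hT : IsRightQLinear (T : H → H)) {l m q : ℍ[ℝ]}
    (hq : l * q = q * m) (x : H) : op q • opTlam T l x = opTlam T m (op q • x) := by
  simp only [opTlam, smul_sub, hT q x, smul_smul, ← op_mul, hq]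

/-- If `Ran(T_λ)` is dense in `H` then `Ran(T_{λ*})` is dense in `H`. -/
theorem denseRange_Tlam_star [CompleteSpace H] (T : H →L[ℝ] H)
    (hT : IsRightQLinear (T : H → H))
    (hreal : ∀ (r : ℝ) (x : H), op ((r : ℍ[ℝ])) • x = r • x)
    (hnorm : ∀ (x : H) (q : ℍ[ℝ]), ‖op q • x‖ = ‖x‖ * ‖q‖)
    (l : ℍ[ℝ]) (h : Dense (Set.range (opTlam T l))) :
    Dense (Set.range (opTlam T (star l))) := by
  obtain ⟨q, hq0, hq⟩ := Quaternion.exists_ne_zero_mul_eq_mul_star l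
  have hsurj : Function.Surjective fun x : H => op q • x := fun x =>
    ⟨op q⁻¹ • x, by simp [smul_smul, ← op_mul, inv_mul_cancel₀ hq0, -op_inv]⟩
  refine (hsurj.denseRange.dense_image (continuous_op_smul_of_norm hnorm q) h).mono ?_
  rintro _ ⟨_, ⟨x, rfl⟩, rfl⟩
  exact ⟨op q • x, (op_smul_opTlam T hT hq x).symm⟩
end
end
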